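/- Let N ≥ 1, let M be an (N+1)×(N+1) real diagonal matrix, let D be an (N+1)×(N+1) real matrix, and let B = diag(−1,0,…,0,1), satisfying the summation-by-parts property (M D) + (M D)^T = B. Then for every symmetric (N+1)×(N+1) real matrix S (i.e., S_{i m} = S_{m i} for all i, m), the split-form volume contribution telescopes to pure boundary terms: ∑_{i=0}^{N} ∑_{m=0}^{N} 2 (M D)_{i m} S_{i m} = S_{N N} − S_{0 0}. -/

import Mathlib

open Matrix

/-- Against a symmetric matrix, twice a matrix has the same entrywise pairing as its
symmetrization `A + Aᵀ`. -/
theorem sum_two_mul_mul_eq_sum_add_transpose_mul {n R : Type*} [Fintype n] [CommSemiring R]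
    (A S : Matrix n n R) (hS : ∀ i m, S i m = S m i) :
    ∑ i, ∑ m, 2 * A i m * S i m = ∑ i, ∑ m, (A + Aᵀ) i m * S i m := by
  have hswap : ∑ i, ∑ m, A m i * S i m = ∑ i, ∑ m, A i m * S i m := by
    rw [Finset.sum_comm]
    exact Finset.sum_congr rfl fun i _ => Finset.sum_congr rfl fun m _ => by rw [hS m i]
  simp only [Matrix.add_apply, Matrix.transpose_apply, add_mul, two_mul,
    Finset.sum_add_distrib, hswap]

/-- The entrywise pairing of a diagonal matrix with `S` only sees the diagonal of `S`. -/
theorem sum_diagonal_mul {n R : Type*} [Fintype n] [DecidableEq n] [NonUnitalNonAssocSemiring R]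
    (d : n → R) (S : Matrix n n R) :
    ∑ i, ∑ m, Matrix.diagonal d i m * S i m = ∑ i, d i * S i i := by
  simp [Matrix.diagonal_apply, ite_mul]

/-- For a diagonal-norm SBP operator (M, D, B) with
`B = diag(−1,0,…,0,1)` and the SBP property `(M D) + (M D)ᵀ = B`, for every
symmetric matrix S the split-form volume contribution telescopes to boundary
terms: `∑ᵢ ∑ₘ 2 (M D)_{im} S_{im} = S_{NN} − S_{00}`. -/
theorem sbp_split_form_volume_telescopes
    (N : ℕ) (hN : 1 ≤ N)
    (ω : Fin (N + 1) → ℝ)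
    (M D B : Matrix (Fin (N + 1)) (Fin (N + 1)) ℝ)
    (hM : M = Matrix.diagonal ω)
    (hB : B = Matrix.diagonal
      (fun i => if i = 0 then (-1 : ℝ) else if i = Fin.last N then 1 else 0))
    (hSBP : M * D + (M * D)ᵀ = B)
    (S : Matrix (Fin (N + 1)) (Fin (N + 1)) ℝ)
    (hS : ∀ i m, S i m = S m i) :
    ∑ i, ∑ m, 2 * (M * D) i m * S i m
      = S (Fin.last N) (Fin.last N) - S 0 0 := by
  have hlast : Fin.last N ≠ 0 := by
    simp only [ne_eq, Fin.ext_iff, Fin.val_last, Fin.val_zero]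
    omega
  rw [sum_two_mul_mul_eq_sum_add_transpose_mul _ _ hS, hSBP, hB, sum_diagonal_mul,
    Fintype.sum_eq_add 0 (Fin.last N) hlast.symm]
  · simp only [if_true, if_neg hlast]
    ring
  · rintro i ⟨h0, hN'⟩
    simp [h0, hN']
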